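/- arXiv:math/0305036 — 12 statements merged into one kernel-verified Lean document; each statement's English description precedes it below -/
import Mathlib

section
/- For every set A ⊆ 2^ω, every x ∈ 2^ω, and all n,m < ω, the set D_{x,n,m} = {p ∈ ℙ(A) : (∃k < ω) ⌜[x↾k] ⊆ U_{n,m}⌝ ∈ p, or ⌜x ∉ U_{n,m}⌝ ∈ p} is dense in ℙ(A). -/
open Set

/-- Formal sentences for the poset ℙ(A): type (1) `mem x n` is ⌜x ∈ ⋂_{m<ω} U_{n,m}⌝,
type (2) `notMem x n m` is ⌜x ∉ U_{n,m}⌝, type (3) `cylSub s n m` is ⌜[s] ⊆ U_{n,m}⌝. -/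
inductive PSentence : Type
  | mem (x : ℕ → Bool) (n : ℕ)
  | notMem (x : ℕ → Bool) (n m : ℕ)
  | cylSub (s : List Bool) (n m : ℕ)

/-- The basic clopen set [s] = {y ∈ 2^ω : s ⊆ y}. -/
def cyl (s : List Bool) : Set (ℕ → Bool) := {y | ∀ i : Fin s.length, y i = s.get i}

/-- x↾k, the length-k initial segment of x. -/
def restr (x : ℕ → Bool) (k : ℕ) : List Bool := List.ofFn (fun i : Fin k => x i)

/-- Consistency of a set of sentences. -/
def PConsistent (p : Set PSentence) : Prop :=
  (∀ x n k, ¬(PSentence.mem x n ∈ p ∧ PSentence.notMem x n k ∈ p)) ∧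
  (∀ x n m k, ¬(PSentence.notMem x n m ∈ p ∧ PSentence.cylSub (restr x k) n m ∈ p))

/-- The poset ℙ(A): finite consistent sets of sentences whose type (1) sentences
only mention points of A. -/
def PP (A : Set (ℕ → Bool)) : Set (Set PSentence) :=
  {p | p.Finite ∧ (∀ x n, PSentence.mem x n ∈ p → x ∈ A) ∧ PConsistent p}

/-- p and q are compatible iff p ∪ q ∈ ℙ(A). -/
def PCompatible (A : Set (ℕ → Bool)) (p q : Set PSentence) : Prop := p ∪ q ∈ PP A

/-- D is dense in ℙ(A) iff every p ∈ ℙ(A) has an extension (superset) in D. -/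
def PDense (A : Set (ℕ → Bool)) (D : Set (Set PSentence)) : Prop :=
  ∀ p ∈ PP A, ∃ q ∈ D, p ⊆ q

/-- A filter on ℙ(A): a nonempty subset of ℙ(A) closed under subsets (in ℙ(A))
and such that any two members have a common extension in G. -/
def PFilter (A : Set (ℕ → Bool)) (G : Set (Set PSentence)) : Prop :=
  G ⊆ PP A ∧ G.Nonempty ∧
  (∀ p ∈ G, ∀ q ∈ PP A, q ⊆ p → q ∈ G) ∧
  (∀ p ∈ G, ∀ q ∈ G, ∃ r ∈ G, p ⊆ r ∧ q ⊆ r)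

/-- A sentence is in G iff it belongs to some condition in G. -/
def SentIn (G : Set (Set PSentence)) (σ : PSentence) : Prop := ∃ p ∈ G, σ ∈ p

/-- U^G_{n,m} = ⋃{[s] : ⌜[s] ⊆ U_{n,m}⌝ ∈ G}. -/
def Ugen (G : Set (Set PSentence)) (n m : ℕ) : Set (ℕ → Bool) :=
  ⋃ s ∈ {s | SentIn G (PSentence.cylSub s n m)}, cyl s

/-- W^G_n = ⋂_{m<ω} U^G_{n,m}. -/
def Wgen (G : Set (Set PSentence)) (n : ℕ) : Set (ℕ → Bool) := ⋂ m, Ugen G n m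

/-- The dense set D_{x,n,m}. -/
def Dxnm (A : Set (ℕ → Bool)) (x : ℕ → Bool) (n m : ℕ) : Set (Set PSentence) :=
  {p ∈ PP A | (∃ k, PSentence.cylSub (restr x k) n m ∈ p) ∨ PSentence.notMem x n m ∈ p}

/-- The dense set D_{x,n}. -/
def Dxn (A : Set (ℕ → Bool)) (x : ℕ → Bool) (n : ℕ) : Set (Set PSentence) :=
  {p ∈ PP A | (∃ k, PSentence.notMem x n k ∈ p) ∨ PSentence.mem x n ∈ p}

/-- The dense set D_x. -/
def Dx (A : Set (ℕ → Bool)) (x : ℕ → Bool) : Set (Set PSentence) :=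
  {p ∈ PP A | ∃ n, PSentence.mem x n ∈ p}

/-- ℙ(A)_Y: the conditions all of whose type (1) and type (2) sentences
mention only points of Y. -/
def PPY (A Y : Set (ℕ → Bool)) : Set (Set PSentence) :=
  {p | p ∈ PP A ∧ ∀ x, ((∃ n, PSentence.mem x n ∈ p) ∨ (∃ n m, PSentence.notMem x n m ∈ p)) → x ∈ Y}

/-- (p,(t_i,n_i,m_i : i<N)) is a Y-template. -/
def IsTemplate (A Y : Set (ℕ → Bool)) (N : ℕ) (p : Set PSentence)
    (t : Fin N → List Bool) (nn mm : Fin N → ℕ) : Prop :=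
  p ∈ PPY A Y ∧
  (∀ i : Fin N, ∀ y, PSentence.mem y (nn i) ∈ p → y ∉ cyl (t i)) ∧
  (∀ i : Fin N, ∀ s, PSentence.cylSub s (nn i) (mm i) ∈ p → cyl s ∩ cyl (t i) = ∅)

/-- p(x⃗) = p ∪ {⌜x_i ∉ U_{n_i,m_i}⌝ : i < N}. -/
def pvec (p : Set PSentence) {N : ℕ} (nn mm : Fin N → ℕ)
    (x : Fin N → (ℕ → Bool)) : Set PSentence :=
  p ∪ {σ | ∃ i : Fin N, σ = PSentence.notMem (x i) (nn i) (mm i)}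

/-- Σ is an antichain in ℙ(A): a set of pairwise incompatible conditions. -/
def PAntichain (A : Set (ℕ → Bool)) (S : Set (Set PSentence)) : Prop :=
  S ⊆ PP A ∧ ∀ p ∈ S, ∀ q ∈ S, p ≠ q → ¬ PCompatible A p q

/-- Σ is a maximal antichain in ℙ(A). -/
def PMaxAntichain (A : Set (ℕ → Bool)) (S : Set (Set PSentence)) : Prop :=
  PAntichain A S ∧ ∀ p ∈ PP A, ∃ q ∈ S, PCompatible A p q

theorem restr_apply_eq {x y : ℕ → Bool} {k k' i : ℕ} (h : restr y k' = restr x k)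
    (hi : i < k) : y i = x i := by
  have hk : k' = k := by simpa [restr] using congrArg List.length h
  subst hk
  exact congrFun (List.ofFn_injective h) ⟨i, hi⟩

/-- A finite set of points other than `x` misses some cylinder around `x`. -/
theorem exists_restr_ne {Y : Set (ℕ → Bool)} (hY : Y.Finite) {x : ℕ → Bool} (hx : x ∉ Y) :
    ∃ k, ∀ y ∈ Y, ∀ k', restr y k' ≠ restr x k := by
  have h : ∀ y ∈ Y, ∀ᶠ k in Filter.atTop, ∀ k', restr y k' ≠ restr x k := by
    intro y hy
    obtain ⟨i, hi⟩ := Function.ne_iff.mp (ne_of_mem_of_not_mem hy hx)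
    filter_upwards [Filter.eventually_gt_atTop i] with k hk k' h
    exact hi (restr_apply_eq h hk)
  exact ((Filter.eventually_all_finite hY).mpr h).exists

/-- D_{x,n,m} is dense in ℙ(A). -/
theorem dense_Dxnm (A : Set (ℕ → Bool)) (x : ℕ → Bool) (n m : ℕ) :
    PDense A (Dxnm A x n m) := by
  rintro p ⟨hfin, hA, hmem, hcyl⟩
  by_cases hx : PSentence.notMem x n m ∈ p
  · exact ⟨p, ⟨⟨hfin, hA, hmem, hcyl⟩, Or.inr hx⟩, Subset.rfl⟩
  have hY : {y | PSentence.notMem y n m ∈ p}.Finite :=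
    hfin.preimage (f := fun y => PSentence.notMem y n m)
      (fun a _ b _ h => (PSentence.notMem.inj h).1)
  obtain ⟨k, hk⟩ := exists_restr_ne hY hx
  refine ⟨insert (PSentence.cylSub (restr x k) n m) p,
    ⟨⟨hfin.insert _, ?_, ?_, ?_⟩, Or.inl ⟨k, mem_insert _ _⟩⟩, subset_insert _ _⟩
  · intro y l h
    exact hA y l (by simpa using h)
  · intro y l j h
    exact hmem y l j (by simpa using h)
  · rintro y l j k' ⟨h₁, h₂⟩
    have hy : PSentence.notMem y l j ∈ p := by simpa using h₁
    rcases h₂ with h₂ | h₂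
    · obtain ⟨hr, rfl, rfl⟩ := PSentence.cylSub.inj h₂
      exact hk y hy k' hr
    · exact hcyl y l j k' ⟨hy, h₂⟩
end

section
/- For every set A ⊆ 2^ω, every x ∈ 2^ω, and every n < ω, the set D_{x,n} = {p ∈ ℙ(A) : (∃k < ω) ⌜x ∉ U_{n,k}⌝ ∈ p, or ⌜x ∈ ⋂_{m<ω} U_{n,m}⌝ ∈ p} is dense in ℙ(A). -/
open Set

/-- A finite set of sentences leaves some index `k` free of type (3) sentences about `U_{n,k}`. -/
theorem exists_forall_cylSub_notMem {p : Set PSentence} (hp : p.Finite) (n : ℕ) :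
    ∃ k, ∀ s, PSentence.cylSub s n k ∉ p := by
  let f : PSentence → ℕ
    | .mem _ _ => 0
    | .notMem _ _ _ => 0
    | .cylSub _ _ m => m
  obtain ⟨k, hk⟩ := (hp.image f).exists_notMem
  exact ⟨k, fun s hs => hk ⟨_, hs, rfl⟩⟩

/-- A type (2) sentence that contradicts no sentence of a condition can be added to it. -/
theorem insert_notMem_mem_PP {A : Set (ℕ → Bool)} {p : Set PSentence} (hp : p ∈ PP A)
    {x : ℕ → Bool} {n m : ℕ} (hmem : PSentence.mem x n ∉ p)
    (hcyl : ∀ k, PSentence.cylSub (restr x k) n m ∉ p) :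
    insert (PSentence.notMem x n m) p ∈ PP A := by
  obtain ⟨hfin, hA, hc₁, hc₂⟩ := hp
  refine ⟨hfin.insert _, fun y i hy => hA y i (by simpa using hy), ?_, ?_⟩
  · rintro y i j ⟨h₁, h₂⟩
    have h₁ : PSentence.mem y i ∈ p := by simpa using h₁
    rcases h₂ with h₂ | h₂
    · cases h₂
      exact hmem h₁
    · exact hc₁ y i j ⟨h₁, h₂⟩
  · rintro y i j k ⟨h₁, h₂⟩
    have h₂ : PSentence.cylSub (restr y k) i j ∈ p := by simpa using h₂
    rcases h₁ with h₁ | h₁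
    · cases h₁
      exact hcyl k h₂
    · exact hc₂ y i j k ⟨h₁, h₂⟩

/-- D_{x,n} is dense in ℙ(A). -/
theorem dense_Dxn (A : Set (ℕ → Bool)) (x : ℕ → Bool) (n : ℕ) :
    PDense A (Dxn A x n) := by
  intro p hp
  by_cases hmem : PSentence.mem x n ∈ p
  · exact ⟨p, ⟨hp, Or.inr hmem⟩, Subset.rfl⟩
  · obtain ⟨k, hk⟩ := exists_forall_cylSub_notMem hp.1 n
    exact ⟨_, ⟨insert_notMem_mem_PP hp hmem fun _ => hk _, Or.inl ⟨k, mem_insert _ _⟩⟩,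
      subset_insert _ _⟩
end

section
/- For every set A ⊆ 2^ω and every x ∈ A, the set D_x = {p ∈ ℙ(A) : (∃n < ω) ⌜x ∈ ⋂_{m<ω} U_{n,m}⌝ ∈ p} is dense in ℙ(A). -/
open Set

/-- The index `n` of the family `U_{n,m}` that a sentence speaks about. -/
def PSentence.index : PSentence → ℕ
  | .mem _ n => n
  | .notMem _ n _ => n
  | .cylSub _ n _ => n

/-- A finite set of sentences leaves some index unused. -/
theorem exists_index_ne {p : Set PSentence} (hp : p.Finite) : ∃ n, ∀ σ ∈ p, σ.index ≠ n := by
  obtain ⟨n, hn⟩ := (hp.image PSentence.index).exists_notMem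
  exact ⟨n, fun σ hσ h => hn ⟨σ, hσ, h⟩⟩

/-- A type (1) sentence may be added to a condition having no type (2) sentence
with the same point and index. -/
theorem insert_mem_PP {A : Set (ℕ → Bool)} {x : ℕ → Bool} {n : ℕ} {p : Set PSentence}
    (hx : x ∈ A) (hp : p ∈ PP A) (h : ∀ k, PSentence.notMem x n k ∉ p) :
    insert (PSentence.mem x n) p ∈ PP A := by
  obtain ⟨hfin, hA, hc₁, hc₂⟩ := hp
  refine ⟨hfin.insert _, ?_, ?_, ?_⟩
  · rintro y m (hy | hy)
    · cases hy
      exact hx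
    · exact hA y m hy
  · rintro y m k ⟨hy | hy, hz | hz⟩
    · cases hz
    · cases hy
      exact h k hz
    · cases hz
    · exact hc₁ y m k ⟨hy, hz⟩
  · rintro y m l k ⟨hy | hy, hz | hz⟩
    · cases hy
    · cases hy
    · cases hz
    · exact hc₂ y m l k ⟨hy, hz⟩

/-- for x ∈ A, D_x is dense in ℙ(A). -/
theorem dense_Dx (A : Set (ℕ → Bool)) (x : ℕ → Bool) (hx : x ∈ A) :
    PDense A (Dx A x) := by
  intro p hp
  obtain ⟨n, hn⟩ := exists_index_ne hp.1
  exact ⟨insert (PSentence.mem x n) p,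
    ⟨insert_mem_PP hx hp fun k hk => hn _ hk rfl, n, Set.mem_insert _ _⟩,
    Set.subset_insert _ _⟩
end

section
/- Let A ⊆ 2^ω and let G be a filter on ℙ(A) which meets D_{x,n,m} = {p ∈ ℙ(A) : (∃k) ⌜[x↾k] ⊆ U_{n,m}⌝ ∈ p, or ⌜x ∉ U_{n,m}⌝ ∈ p} for every x ∈ 2^ω and all n,m < ω. Then for every x ∈ 2^ω and all n,m < ω: x ∉ U^G_{n,m} if and only if ⌜x ∉ U_{n,m}⌝ ∈ G. -/
open Set

theorem mem_cyl_iff {x : ℕ → Bool} {s : List Bool} :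
    x ∈ cyl s ↔ restr x s.length = s := by
  constructor
  · intro h
    apply List.ext_get
    · simp [restr]
    · intro i _ hi
      simpa [restr] using h ⟨i, hi⟩
  · intro h i
    have hi : i.1 < (restr x s.length).length := by simp [restr]
    have key : (restr x s.length)[i.1] = s[i.1] := by simp only [h]
    simpa [restr] using key

theorem mem_cyl_restr (x : ℕ → Bool) (k : ℕ) : x ∈ cyl (restr x k) := by
  simp [mem_cyl_iff, restr]

theorem mem_Ugen_iff {G : Set (Set PSentence)} {x : ℕ → Bool} {n m : ℕ} :
    x ∈ Ugen G n m ↔ ∃ k, SentIn G (PSentence.cylSub (restr x k) n m) := by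
  simp only [Ugen, mem_iUnion, mem_ofPred_eq, exists_prop]
  constructor
  · rintro ⟨s, hs, hx⟩
    exact ⟨s.length, by rwa [mem_cyl_iff.1 hx]⟩
  · rintro ⟨k, hk⟩
    exact ⟨restr x k, hk, mem_cyl_restr x k⟩

/-- if the filter G meets every D_{x,n,m}, then
x ∉ U^G_{n,m} iff ⌜x ∉ U_{n,m}⌝ ∈ G. -/
theorem notMem_Ugen_iff (A : Set (ℕ → Bool)) (G : Set (Set PSentence))
    (hG : PFilter A G)
    (hmeet : ∀ (x : ℕ → Bool) (n m : ℕ), (G ∩ Dxnm A x n m).Nonempty) :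
    ∀ (x : ℕ → Bool) (n m : ℕ),
      x ∉ Ugen G n m ↔ SentIn G (PSentence.notMem x n m) := by
  intro x n m
  rw [mem_Ugen_iff]
  constructor
  · intro hx
    obtain ⟨p, hpG, -, ⟨k, hk⟩ | hp⟩ := hmeet x n m
    · exact absurd ⟨k, p, hpG, hk⟩ hx
    · exact ⟨p, hpG, hp⟩
  · rintro ⟨p, hpG, hp⟩ ⟨k, q, hqG, hq⟩
    obtain ⟨r, hrG, hpr, hqr⟩ := hG.2.2.2 p hpG q hqG
    exact (hG.1 hrG).2.2.2 x n m k ⟨hpr hp, hqr hq⟩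
end

section
/- Let A ⊆ 2^ω and let G be a filter on ℙ(A) which, for every x ∈ 2^ω and all n,m < ω, meets D_{x,n,m} = {p ∈ ℙ(A) : (∃k) ⌜[x↾k] ⊆ U_{n,m}⌝ ∈ p, or ⌜x ∉ U_{n,m}⌝ ∈ p} and meets D_{x,n} = {p ∈ ℙ(A) : (∃k) ⌜x ∉ U_{n,k}⌝ ∈ p, or ⌜x ∈ ⋂_{m<ω} U_{n,m}⌝ ∈ p}. Then for every x ∈ 2^ω and every n < ω: x ∈ W^G_n if and only if ⌜x ∈ ⋂_{m<ω} U_{n,m}⌝ ∈ G. -/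
open Set

theorem mem_cyl_iff_exists_restr {x : ℕ → Bool} {s : List Bool} :
    x ∈ cyl s ↔ ∃ k, restr x k = s := by
  constructor
  · intro h
    refine ⟨s.length, List.ext_get (by simp [restr]) fun i _ h₂ => ?_⟩
    simpa [restr] using h ⟨i, h₂⟩
  · rintro ⟨k, rfl⟩ i
    exact (List.getElem_ofFn i.isLt).symm

theorem PFilter.exists_mem_of_sentIn {A : Set (ℕ → Bool)} {G : Set (Set PSentence)}
    (hG : PFilter A G) {σ τ : PSentence} (hσ : SentIn G σ) (hτ : SentIn G τ) :
    ∃ r ∈ PP A, σ ∈ r ∧ τ ∈ r := by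
  obtain ⟨p, hp, hσp⟩ := hσ
  obtain ⟨q, hq, hτq⟩ := hτ
  obtain ⟨r, hr, hpr, hqr⟩ := hG.2.2.2 p hp q hq
  exact ⟨r, hG.1 hr, hpr hσp, hqr hτq⟩

/-- if the filter G meets every D_{x,n,m} and every D_{x,n}, then
x ∈ W^G_n iff ⌜x ∈ ⋂_{m<ω} U_{n,m}⌝ ∈ G. -/
theorem mem_Wgen_iff (A : Set (ℕ → Bool)) (G : Set (Set PSentence))
    (hG : PFilter A G)
    (hmeet1 : ∀ (x : ℕ → Bool) (n m : ℕ), (G ∩ Dxnm A x n m).Nonempty)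
    (hmeet2 : ∀ (x : ℕ → Bool) (n : ℕ), (G ∩ Dxn A x n).Nonempty) :
    ∀ (x : ℕ → Bool) (n : ℕ),
      x ∈ Wgen G n ↔ SentIn G (PSentence.mem x n) := by
  intro x n
  simp only [Wgen, mem_iInter, mem_Ugen_iff]
  constructor
  · intro h
    obtain ⟨p, hpG, -, ⟨m, hm⟩ | hmem⟩ := hmeet2 x n
    · obtain ⟨k, hk⟩ := h m
      obtain ⟨r, hr, h₁, h₂⟩ := hG.exists_mem_of_sentIn ⟨p, hpG, hm⟩ hk
      exact (hr.2.2.2 x n m k ⟨h₁, h₂⟩).elim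
    · exact ⟨p, hpG, hmem⟩
  · intro h m
    obtain ⟨p, hpG, -, ⟨k, hk⟩ | hnot⟩ := hmeet1 x n m
    · exact ⟨k, p, hpG, hk⟩
    · obtain ⟨r, hr, h₁, h₂⟩ := hG.exists_mem_of_sentIn h ⟨p, hpG, hnot⟩
      exact (hr.2.2.1 x n m ⟨h₁, h₂⟩).elim
end

section
/- Let A ⊆ 2^ω and let G be a filter on ℙ(A) which, for every x ∈ 2^ω and all n,m < ω, meets D_{x,n,m} = {p ∈ ℙ(A) : (∃k) ⌜[x↾k] ⊆ U_{n,m}⌝ ∈ p, or ⌜x ∉ U_{n,m}⌝ ∈ p} and meets D_{x,n} = {p ∈ ℙ(A) : (∃k) ⌜x ∉ U_{n,k}⌝ ∈ p, or ⌜x ∈ ⋂_{m<ω} U_{n,m}⌝ ∈ p}, and which for every x ∈ A meets D_x = {p ∈ ℙ(A) : (∃n) ⌜x ∈ ⋂_{m<ω} U_{n,m}⌝ ∈ p}. Then for every x ∈ 2^ω: x ∈ A if and only if x ∈ ⋃_{n<ω} W^G_n. -/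
open Set

theorem restr_length_of_mem_cyl {x : ℕ → Bool} {s : List Bool} (h : x ∈ cyl s) :
    restr x s.length = s := by
  apply List.ext_get
  · simp [restr]
  · intro i _ hi
    simpa [restr] using h ⟨i, hi⟩

theorem PFilter.not_notMem_of_mem {A : Set (ℕ → Bool)} {G : Set (Set PSentence)}
    (hG : PFilter A G) {x : ℕ → Bool} {n m : ℕ} (h : SentIn G (.mem x n)) :
    ¬ SentIn G (.notMem x n m) := by
  rintro ⟨q, hq, hxq⟩
  obtain ⟨p, hp, hxp⟩ := h
  obtain ⟨r, hr, hpr, hqr⟩ := hG.2.2.2 p hp q hq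
  exact (hG.1 hr).2.2.1 x n m ⟨hpr hxp, hqr hxq⟩

theorem PFilter.not_notMem_of_mem_Ugen {A : Set (ℕ → Bool)} {G : Set (Set PSentence)}
    (hG : PFilter A G) {x : ℕ → Bool} {n m : ℕ} (h : x ∈ Ugen G n m) :
    ¬ SentIn G (.notMem x n m) := by
  rintro ⟨q, hq, hxq⟩
  simp only [Ugen, mem_iUnion] at h
  obtain ⟨s, ⟨p, hp, hsp⟩, hxs⟩ := h
  obtain ⟨r, hr, hpr, hqr⟩ := hG.2.2.2 p hp q hq
  refine (hG.1 hr).2.2.2 x n m s.length ⟨hqr hxq, ?_⟩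
  rw [restr_length_of_mem_cyl hxs]
  exact hpr hsp

/-- if the filter G meets every D_{x,n,m}, every D_{x,n}, and D_x for
every x ∈ A, then x ∈ A iff x ∈ ⋃_{n<ω} W^G_n. -/
theorem mem_A_iff_mem_iUnion_Wgen (A : Set (ℕ → Bool)) (G : Set (Set PSentence))
    (hG : PFilter A G)
    (hmeet1 : ∀ (x : ℕ → Bool) (n m : ℕ), (G ∩ Dxnm A x n m).Nonempty)
    (hmeet2 : ∀ (x : ℕ → Bool) (n : ℕ), (G ∩ Dxn A x n).Nonempty)
    (hmeet3 : ∀ x ∈ A, (G ∩ Dx A x).Nonempty) :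
    ∀ x : ℕ → Bool, x ∈ A ↔ x ∈ ⋃ n : ℕ, Wgen G n := by
  intro x
  simp only [mem_iUnion, Wgen, mem_iInter]
  constructor
  · intro hx
    obtain ⟨p, hp, -, n, hxp⟩ := hmeet3 x hx
    refine ⟨n, fun m => ?_⟩
    obtain ⟨q, hq, -, ⟨k, hk⟩ | hxq⟩ := hmeet1 x n m
    · exact mem_biUnion (show _ ∈ {s | SentIn G (.cylSub s n m)} from ⟨q, hq, hk⟩)
        (mem_cyl_restr x k)
    · exact absurd ⟨q, hq, hxq⟩ (hG.not_notMem_of_mem ⟨p, hp, hxp⟩)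
  · rintro ⟨n, hn⟩
    obtain ⟨p, hp, hpA, ⟨k, hk⟩ | hxp⟩ := hmeet2 x n
    · exact absurd ⟨p, hp, hk⟩ (hG.not_notMem_of_mem_Ugen (hn k))
    · exact hpA.2.1 x n hxp
end

section
/- Let A ⊆ 2^ω and p,q ∈ ℙ(A). Suppose p and q contain exactly the same sentences of type (3) (sentences ⌜[s] ⊆ U_{n,m}⌝), and for every x ∈ 2^ω which is mentioned in both p and q (i.e., x occurs in a type (1) or type (2) sentence of p and also in one of q), p and q contain exactly the same sentences mentioning x. Then p ∪ q is consistent, i.e., p ∪ q ∈ ℙ(A) and p,q are compatible. -/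
open Set

/-- x is mentioned in p: x occurs in a type (1) or type (2) sentence of p. -/
def Mentions (p : Set PSentence) (x : ℕ → Bool) : Prop :=
  (∃ n, PSentence.mem x n ∈ p) ∨ (∃ n m, PSentence.notMem x n m ∈ p)

/-- if p,q ∈ ℙ(A) agree on all type (3) sentences and agree on all
sentences mentioning any x mentioned in both, then p ∪ q ∈ ℙ(A), i.e., p and q
are compatible. -/
theorem compat_of_agree (A : Set (ℕ → Bool)) (p q : Set PSentence)
    (hp : p ∈ PP A) (hq : q ∈ PP A)
    (h3 : ∀ s n m, PSentence.cylSub s n m ∈ p ↔ PSentence.cylSub s n m ∈ q)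
    (hx : ∀ x, Mentions p x → Mentions q x →
      (∀ n, PSentence.mem x n ∈ p ↔ PSentence.mem x n ∈ q) ∧
      (∀ n m, PSentence.notMem x n m ∈ p ↔ PSentence.notMem x n m ∈ q)) :
    p ∪ q ∈ PP A ∧ PCompatible A p q := by
  obtain ⟨hpf, hpA, hp₁, hp₂⟩ := hp
  obtain ⟨hqf, hqA, hq₁, hq₂⟩ := hq
  have union_mem : p ∪ q ∈ PP A := by
    refine ⟨hpf.union hqf, fun x n h => h.elim (hpA x n) (hqA x n), ?_, ?_⟩
    · rintro x n k ⟨h | h, h' | h'⟩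
      · exact hp₁ x n k ⟨h, h'⟩
      · exact hq₁ x n k ⟨((hx x (.inl ⟨n, h⟩) (.inr ⟨n, k, h'⟩)).1 n).1 h, h'⟩
      · exact hp₁ x n k ⟨((hx x (.inr ⟨n, k, h'⟩) (.inl ⟨n, h⟩)).1 n).2 h, h'⟩
      · exact hq₁ x n k ⟨h, h'⟩
    · rintro x n m k ⟨h | h, h'⟩
      · exact hp₂ x n m k ⟨h, h'.elim id (h3 _ n m).2⟩
      · exact hq₂ x n m k ⟨h, h'.elim (h3 _ n m).1 id⟩
  exact ⟨union_mem, union_mem⟩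
end

section
/- For every set A ⊆ 2^ω, the poset ℙ(A) is ccc: every antichain in ℙ(A) (set of pairwise incompatible conditions) is countable. -/
open Set

/-- The points of `2^ω` mentioned by a sentence of type (1) or (2). -/
def PSentence.points : PSentence → Set (ℕ → Bool)
  | .mem x _ => {x}
  | .notMem x _ _ => {x}
  | .cylSub _ _ _ => ∅

lemma PSentence.finite_points (σ : PSentence) : σ.points.Finite := by
  cases σ <;> simp [PSentence.points]

/-- The trace of a sentence in which each point is replaced by its initial segment
of length `k`. -/
def PSentence.trace (k : ℕ) :
    PSentence → (List Bool × ℕ) ⊕ (List Bool × ℕ × ℕ) ⊕ (List Bool × ℕ × ℕ)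
  | .mem x n => .inl (restr x k, n)
  | .notMem x n m => .inr (.inl (restr x k, n, m))
  | .cylSub s n m => .inr (.inr (s, n, m))

lemma apply_eq_of_restr_eq {x y : ℕ → Bool} {k i : ℕ} (h : restr x k = restr y k) (hi : i < k) :
    x i = y i :=
  congrFun (List.ofFn_injective h) ⟨i, hi⟩

/-- The points of a finite set are separated by their initial segments of some fixed length. -/
lemma exists_injOn_restr {F : Set (ℕ → Bool)} (hF : F.Finite) :
    ∃ k, F.InjOn fun x => restr x k := by
  have h : ∀ᶠ k in Filter.atTop, ∀ x ∈ F, ∀ y ∈ F, restr x k = restr y k → x = y := by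
    refine (Filter.eventually_all_finite hF).2 fun x _ =>
      (Filter.eventually_all_finite hF).2 fun y _ => ?_
    by_cases hxy : x = y
    · exact .of_forall fun _ _ => hxy
    · obtain ⟨i, hi⟩ := Function.ne_iff.1 hxy
      filter_upwards [Filter.eventually_gt_atTop i] with k hk h
      exact absurd (apply_eq_of_restr_eq h hk) hi
  obtain ⟨k, hk⟩ := h.exists
  exact ⟨k, fun x hx y hy => hk x hx y hy⟩

/-- Let `p` be a consistent set whose points are separated at length `k`. If `q` has the same
traces as `p` at length `k`, then no sentence of `p` contradicts a sentence of `q`. -/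
lemma PConsistent.not_conflict {p q : Set PSentence} {k : ℕ} (hp : PConsistent p)
    (hk : (⋃ σ ∈ p, σ.points).InjOn fun x => restr x k)
    (h : PSentence.trace k '' p = PSentence.trace k '' q) :
    (∀ x n m, PSentence.mem x n ∈ p → PSentence.notMem x n m ∉ q) ∧
    (∀ x n m l, PSentence.notMem x n m ∈ p → PSentence.cylSub (restr x l) n m ∉ q) := by
  constructor
  · intro x n m hx hq
    obtain ⟨σ, hσ, hσx⟩ := h.symm ▸ Set.mem_image_of_mem (PSentence.trace k) hq
    cases σ with
    | notMem y n' m' =>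
      simp only [PSentence.trace, Sum.inr.injEq, Sum.inl.injEq, Prod.mk.injEq] at hσx
      obtain ⟨hxy, rfl, rfl⟩ := hσx
      obtain rfl : y = x := hk (Set.mem_biUnion hσ rfl) (Set.mem_biUnion hx rfl) hxy
      exact hp.1 _ _ _ ⟨hx, hσ⟩
    | _ => simp [PSentence.trace] at hσx
  · intro x n m l hx hq
    obtain ⟨σ, hσ, hσx⟩ := h.symm ▸ Set.mem_image_of_mem (PSentence.trace k) hq
    cases σ with
    | cylSub s n' m' =>
      simp only [PSentence.trace, Sum.inr.injEq, Prod.mk.injEq] at hσx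
      obtain ⟨rfl, rfl, rfl⟩ := hσx
      exact hp.2 _ _ _ _ ⟨hx, hσ⟩
    | _ => simp [PSentence.trace] at hσx

/-- Conditions with the same traces at a length separating the points of each are compatible. -/
lemma pCompatible_of_trace_image_eq {A : Set (ℕ → Bool)} {p q : Set PSentence} {k : ℕ}
    (hp : p ∈ PP A) (hq : q ∈ PP A)
    (hpk : (⋃ σ ∈ p, σ.points).InjOn fun x => restr x k)
    (hqk : (⋃ σ ∈ q, σ.points).InjOn fun x => restr x k)
    (h : PSentence.trace k '' p = PSentence.trace k '' q) : PCompatible A p q := by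
  obtain ⟨hpf, hpA, hpc⟩ := hp
  obtain ⟨hqf, hqA, hqc⟩ := hq
  obtain ⟨hpq₁, hpq₂⟩ := hpc.not_conflict hpk h
  obtain ⟨hqp₁, hqp₂⟩ := hqc.not_conflict hqk h.symm
  refine ⟨hpf.union hqf, fun x n hx => hx.elim (hpA x n) (hqA x n), ?_, ?_⟩
  · rintro x n m ⟨h₁ | h₁, h₂ | h₂⟩
    · exact hpc.1 _ _ _ ⟨h₁, h₂⟩
    · exact hpq₁ _ _ _ h₁ h₂
    · exact hqp₁ _ _ _ h₁ h₂
    · exact hqc.1 _ _ _ ⟨h₁, h₂⟩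
  · rintro x n m l ⟨h₁ | h₁, h₂ | h₂⟩
    · exact hpc.2 _ _ _ _ ⟨h₁, h₂⟩
    · exact hpq₂ _ _ _ _ h₁ h₂
    · exact hqp₂ _ _ _ _ h₁ h₂
    · exact hqc.2 _ _ _ _ ⟨h₁, h₂⟩

/-- ℙ(A) is ccc — every antichain is countable. -/
theorem PP_ccc (A : Set (ℕ → Bool)) (S : Set (Set PSentence))
    (hS : PAntichain A S) : S.Countable := by
  have hfin (p : S) : (p : Set PSentence).Finite := (hS.1 p.2).1
  choose k hk using fun p : S =>
    exists_injOn_restr ((hfin p).biUnion fun σ _ => σ.finite_points)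
  have hinj : Function.Injective fun p : S =>
      (k p, ((hfin p).image (PSentence.trace (k p))).toFinset) := by
    intro p q hpq
    simp only [Prod.mk.injEq, Set.Finite.toFinset_inj] at hpq
    obtain ⟨hkpq, htr⟩ := hpq
    by_contra hne
    refine hS.2 p p.2 q q.2 (Subtype.coe_ne_coe.2 hne) ?_
    exact pCompatible_of_trace_image_eq (hS.1 p.2) (hS.1 q.2) (hk p) (hkpq ▸ hk q)
      (htr.trans (by rw [hkpq]))
  exact Set.countable_coe_iff.1 hinj.countable
end

section
/- Let A ⊆ 2^ω, Y ⊆ 2^ω, p ∈ ℙ(A), and q ∈ ℙ(A)_Y. Let r = p \ {⌜x ∈ ⋂_{m<ω} U_{n,m}⌝ : x ∉ Y, n < ω}. Then p and q are compatible if and only if r and q are compatible. -/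
open Set

/-- Every subset of a condition in ℙ(A) is again a condition in ℙ(A). -/
theorem mem_PP_of_subset {A : Set (ℕ → Bool)} {p q : Set PSentence} (hpq : p ⊆ q)
    (hq : q ∈ PP A) : p ∈ PP A :=
  ⟨hq.1.subset hpq, fun x n h => hq.2.1 x n (hpq h),
    fun x n k h => hq.2.2.1 x n k ⟨hpq h.1, hpq h.2⟩,
    fun x n m k h => hq.2.2.2 x n m k ⟨hpq h.1, hpq h.2⟩⟩

/-- for p ∈ ℙ(A) and q ∈ ℙ(A)_Y, p and q are compatible iff
r and q are compatible, where r is obtained from p by deleting all type (1)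
sentences mentioning points outside Y. -/
theorem compat_iff_compat_restrict (A Y : Set (ℕ → Bool)) (p q : Set PSentence)
    (hp : p ∈ PP A) (hq : q ∈ PPY A Y) :
    PCompatible A p q ↔
      PCompatible A {σ ∈ p | ∀ x n, σ = PSentence.mem x n → x ∈ Y} q := by
  obtain ⟨hpfin, hpA, hp₁, -⟩ := hp
  obtain ⟨⟨hqfin, hqA, -, -⟩, hqY⟩ := hq
  constructor
  · exact mem_PP_of_subset (union_subset_union_left q (sep_subset _ _))
  · rintro ⟨-, -, h₁, h₂⟩
    have hnotMem : ∀ x n m, PSentence.notMem x n m ∈ p ∪ q → PSentence.notMem x n m ∈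
        {σ ∈ p | ∀ x n, σ = PSentence.mem x n → x ∈ Y} ∪ q := fun x n m h =>
      h.imp_left fun h => ⟨h, by simp⟩
    refine ⟨hpfin.union hqfin, fun x n h => h.elim (hpA x n) (hqA x n), ?_, ?_⟩
    · rintro x n k ⟨hm, hk⟩
      by_cases hx : x ∈ Y
      · exact h₁ x n k ⟨hm.imp_left fun h => ⟨h, by simp [hx]⟩, hnotMem x n k hk⟩
      · exact hp₁ x n k ⟨hm.resolve_right fun h => hx (hqY x (.inl ⟨n, h⟩)),
          hk.resolve_right fun h => hx (hqY x (.inr ⟨n, k, h⟩))⟩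
    · rintro x n m k ⟨hm, hk⟩
      exact h₂ x n m k ⟨hnotMem x n m hm, hk.imp_left fun h => ⟨h, by simp⟩⟩
end

section
/- Let A ⊆ 2^ω, Y ⊆ 2^ω, let (p,(t_i,n_i,m_i : i<N)) be a Y-template, and let q ∈ ℙ(A)_Y. Then the set U_q = {x⃗ ∈ ∏_{i<N}[t_i] : p(x⃗) ∪ q ∈ ℙ(A)} is an open subset of the product space ∏_{i<N}[t_i] (where each [t_i] carries the subspace topology from 2^ω). -/
open Set

/-- A point lies in `cyl s` iff `s` is one of its initial segments. -/
lemma mem_cyl_iff_exists_eq_restr {s : List Bool} {x : ℕ → Bool} :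
    x ∈ cyl s ↔ ∃ k, s = restr x k := by
  constructor
  · intro h
    refine ⟨s.length, List.ext_get (by simp [restr]) fun i hi _ => ?_⟩
    simpa [restr] using (h ⟨i, hi⟩).symm
  · rintro ⟨k, rfl⟩ i
    exact ((List.get_eq_getElem).trans (List.getElem_ofFn i.2)).symm

lemma isClosed_cyl (s : List Bool) : IsClosed (cyl s) := by
  have h : cyl s = ⋂ i : Fin s.length, {y | y i = s.get i} := by
    ext y
    simp [cyl]
  rw [h]
  exact isClosed_iInter fun i => isClosed_eq (continuous_apply _) continuous_const

/-- The points `x` for which ⌜x ∉ U_{n,m}⌝ is consistent with a given sentence form an open set. -/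
lemma isOpen_setOf_notMem_consistent (σ : PSentence) (n m : ℕ) :
    IsOpen {x : ℕ → Bool | σ ≠ .mem x n ∧ ∀ k, σ ≠ .cylSub (restr x k) n m} := by
  cases σ with
  | mem y l =>
    by_cases hl : l = n
    · have h : {x : ℕ → Bool | PSentence.mem y l ≠ .mem x n ∧
          ∀ k, PSentence.mem y l ≠ .cylSub (restr x k) n m} = {y}ᶜ := by
        ext x
        simp [hl, eq_comm]
      rw [h]
      exact isOpen_compl_singleton
    · simp [hl]
  | notMem y l j => simp
  | cylSub s l j =>
    by_cases hl : l = n ∧ j = m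
    · have h : {x : ℕ → Bool | PSentence.cylSub s l j ≠ .mem x n ∧
          ∀ k, PSentence.cylSub s l j ≠ .cylSub (restr x k) n m} = (cyl s)ᶜ := by
        ext x
        simp [hl.1, hl.2, mem_cyl_iff_exists_eq_restr]
      rw [h]
      exact (isClosed_cyl s).isOpen_compl
    · have h : ∀ x k, PSentence.cylSub s l j ≠ .cylSub (restr x k) n m := by
        intro x k h
        injection h with _ h₁ h₂
        exact hl ⟨h₁, h₂⟩
      simp [h]

lemma pvec_union_mem_PP_iff {A : Set (ℕ → Bool)} {N : ℕ} {p q : Set PSentence}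
    {nn mm : Fin N → ℕ} {x : Fin N → (ℕ → Bool)} :
    pvec p nn mm x ∪ q ∈ PP A ↔ p ∪ q ∈ PP A ∧ ∀ i, ∀ σ ∈ p ∪ q,
      σ ≠ .mem (x i) (nn i) ∧ ∀ k, σ ≠ .cylSub (restr (x i) k) (nn i) (mm i) := by
  have hsub : p ∪ q ⊆ pvec p nn mm x ∪ q := union_subset_union_left q subset_union_left
  have hnew : ∀ i, PSentence.notMem (x i) (nn i) (mm i) ∈ pvec p nn mm x ∪ q :=
    fun i => .inl (.inr ⟨i, rfl⟩)
  have hmem : ∀ σ ∈ pvec p nn mm x ∪ q,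
      σ ∈ p ∪ q ∨ ∃ i, σ = .notMem (x i) (nn i) (mm i) := by
    rintro σ ((h | h) | h)
    exacts [.inl (.inl h), .inr h, .inl (.inr h)]
  have hmem₁ : ∀ y n, PSentence.mem y n ∈ pvec p nn mm x ∪ q → PSentence.mem y n ∈ p ∪ q :=
    fun y n h => (hmem _ h).resolve_right (by simp)
  have hmem₃ : ∀ s n m, PSentence.cylSub s n m ∈ pvec p nn mm x ∪ q →
      PSentence.cylSub s n m ∈ p ∪ q :=
    fun s n m h => (hmem _ h).resolve_right (by simp)
  constructor
  · rintro ⟨hfin, hA, hc₁, hc₂⟩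
    refine ⟨⟨hfin.subset hsub, fun y n h => hA y n (hsub h),
      fun y n k h => hc₁ y n k ⟨hsub h.1, hsub h.2⟩,
      fun y n m k h => hc₂ y n m k ⟨hsub h.1, hsub h.2⟩⟩, fun i σ hσ => ⟨?_, ?_⟩⟩
    · rintro rfl
      exact hc₁ _ _ _ ⟨hsub hσ, hnew i⟩
    · rintro k rfl
      exact hc₂ _ _ _ _ ⟨hnew i, hsub hσ⟩
  · rintro ⟨⟨hfin, hA, hc₁, hc₂⟩, hx⟩
    refine ⟨(hfin.union (finite_range fun i => PSentence.notMem (x i) (nn i) (mm i))).subset ?_,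
      fun y n h => hA y n (hmem₁ y n h), ?_, ?_⟩
    · intro σ hσ
      exact (hmem σ hσ).imp_right fun ⟨i, hi⟩ => ⟨i, hi.symm⟩
    · rintro y n k ⟨h₁, h₂⟩
      rcases hmem _ h₂ with h₂ | ⟨i, hi⟩
      · exact hc₁ y n k ⟨hmem₁ y n h₁, h₂⟩
      · injection hi with hy hn
        subst hy hn
        exact (hx i _ (hmem₁ _ _ h₁)).1 rfl
    · rintro y n m k ⟨h₁, h₂⟩
      rcases hmem _ h₁ with h₁ | ⟨i, hi⟩
      · exact hc₂ y n m k ⟨h₁, hmem₃ _ n m h₂⟩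
      · injection hi with hy hn hm
        subst hy hn hm
        exact (hx i _ (hmem₃ _ _ _ h₂)).2 k rfl

/-- U_q = {x⃗ ∈ ∏_{i<N}[t_i] : p(x⃗) ∪ q ∈ ℙ(A)} is open in the
product of the subspaces [t_i] of Cantor space. -/
theorem Uq_isOpen (A Y : Set (ℕ → Bool)) (N : ℕ) (p : Set PSentence)
    (t : Fin N → List Bool) (nn mm : Fin N → ℕ)
    (hT : IsTemplate A Y N p t nn mm)
    (q : Set PSentence) (hq : q ∈ PPY A Y) :
    IsOpen {v : (i : Fin N) → (cyl (t i)) |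
      pvec p nn mm (fun i => (v i : ℕ → Bool)) ∪ q ∈ PP A} := by
  simp only [pvec_union_mem_PP_iff, ofPred_and, ofPred_forall]
  have hfin : (p ∪ q).Finite := hT.1.1.1.union hq.1.1
  refine isOpen_const.inter (isOpen_iInter_of_finite fun i => hfin.isOpen_biInter fun σ _ => ?_)
  have hcont : Continuous fun v : (i : Fin N) → cyl (t i) => (v i : ℕ → Bool) :=
    continuous_subtype_val.comp (continuous_apply i)
  simpa only [ofPred_and, ofPred_forall, preimage_inter, preimage_iInter, preimage_ofPred_eq] using
    (isOpen_setOf_notMem_consistent σ (nn i) (mm i)).preimage hcont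
end

section
/- For every infinite cardinal κ the following are equivalent: (1) 𝔟 > κ, i.e., every family F ⊆ ω^ω with |F| ≤ κ has a ≤*-upper bound; (2) for every X ⊆ 2^ω with |X| ≤ κ and every analytic set A ⊆ 2^ω there exists a Σ⁰₂ set B ⊆ 2^ω (a countable union of closed sets) such that X ∩ A = X ∩ B; (3) for every X ⊆ 2^ω with |X| ≤ κ and every Σ⁰₂ set A ⊆ 2^ω there exists a Π⁰₂ set B ⊆ 2^ω (a countable intersection of open sets) such that X ∩ A = X ∩ B; (4) for every X ⊆ 2^ω with |X| ≤ κ and every countable A ⊆ X there exists a Π⁰₂ set B ⊆ 2^ω such that A = X ∩ B. -/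
open Set

/-- The functions dominated pointwise by `g` form a compact subset of Baire space. -/
theorem isCompact_setOf_forall_le_nat (g : ℕ → ℕ) : IsCompact {y : ℕ → ℕ | ∀ k, y k ≤ g k} := by
  have h := isCompact_univ_pi (s := fun k => Set.Iic (g k)) fun k => (Set.finite_Iic (g k)).isCompact
  convert h using 1
  ext y
  simp [Pi.le_def]

/-- If every family of at most `κ` functions is `≤*`-bounded, then an analytic set agrees with an
`Fσ` set on any set of size at most `κ`. -/
theorem exists_fsigma_inter_eq_of_analyticSet {α : Type} [TopologicalSpace α] [T2Space α]
    {κ : Cardinal}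
    (hb : ∀ F : Set (ℕ → ℕ), Cardinal.mk F ≤ κ →
      ∃ g : ℕ → ℕ, ∀ f ∈ F, ∀ᶠ n in Filter.atTop, f n ≤ g n)
    {X A : Set α} (hX : Cardinal.mk X ≤ κ) (hA : MeasureTheory.AnalyticSet A) :
    ∃ C : ℕ → Set α, (∀ n, IsClosed (C n)) ∧ X ∩ A = X ∩ ⋃ n, C n := by
  rw [MeasureTheory.AnalyticSet] at hA
  rcases hA with rfl | ⟨f, hf, rfl⟩
  · exact ⟨fun _ => ∅, fun _ => isClosed_empty, by simp⟩
  let y : α → ℕ → ℕ := Function.invFun f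
  obtain ⟨g, hg⟩ := hb (y '' X) (Cardinal.mk_image_le.trans hX)
  refine ⟨fun m => f '' {z | ∀ k, z k ≤ max (g k) m}, fun m =>
    ((isCompact_setOf_forall_le_nat _).image hf).isClosed, ?_⟩
  ext x
  simp only [mem_inter_iff, mem_iUnion, and_congr_right_iff]
  refine fun hx => ⟨fun hxf => ?_, ?_⟩
  · obtain ⟨N, hN⟩ := Filter.eventually_atTop.1 (hg _ (mem_image_of_mem y hx))
    refine ⟨(Finset.range N).sup (y x), y x, fun k => ?_, Function.invFun_eq hxf⟩
    rcases lt_or_ge k N with hk | hk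
    · exact le_max_of_le_right (Finset.le_sup (Finset.mem_range.2 hk))
    · exact le_max_of_le_left (hN k hk)
  · rintro ⟨m, z, -, rfl⟩
    exact mem_range_self z

/-- The strictly increasing function of partial sums of `f + 1`. -/
def partialSum (f : ℕ → ℕ) (n : ℕ) : ℕ := ∑ i ∈ Finset.range (n + 1), (f i + 1)

theorem strictMono_partialSum (f : ℕ → ℕ) : StrictMono (partialSum f) :=
  strictMono_nat_of_lt_succ fun n => by
    simp only [partialSum, Finset.sum_range_succ _ (n + 1)]
    omega

theorem le_partialSum (f : ℕ → ℕ) (n : ℕ) : f n ≤ partialSum f n := by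
  simp only [partialSum, Finset.sum_range_succ]
  omega

open Classical in
/-- The characteristic function of the set of values of `partialSum f`. -/
noncomputable def partialSumCode (f : ℕ → ℕ) (k : ℕ) : Bool := decide (k ∈ range (partialSum f))

theorem partialSumCode_eq_true {f : ℕ → ℕ} {k : ℕ} :
    partialSumCode f k = true ↔ k ∈ range (partialSum f) := by
  simp only [partialSumCode, decide_eq_true_eq]

theorem countable_setOf_finite_support :
    {x : ℕ → Bool | {k | x k = true}.Finite}.Countable := by
  refine countable_of_injective_of_countable_image (f := fun x : ℕ → Bool => {k | x k = true}) ?_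
    ((Set.Countable.ofPred_finite (α := ℕ)).mono (by rintro _ ⟨x, hx, rfl⟩; exact hx))
  intro x _ y _ hxy
  funext k
  exact Bool.eq_iff_iff.2 (Set.ext_iff.1 hxy k)

theorem lt_of_lt_count_partialSumCode {f : ℕ → ℕ} {n N : ℕ}
    (h : n < Nat.count (fun k => partialSumCode f k = true) N) : partialSum f n < N := by
  by_contra! hN
  rw [Nat.count_eq_card_filter_range] at h
  have hsub : (Finset.range N).filter (fun k => partialSumCode f k = true) ⊆
      (Finset.range n).image (partialSum f) := by
    intro k hk
    rw [Finset.mem_filter, Finset.mem_range, partialSumCode_eq_true] at hk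
    obtain ⟨hkN, i, rfl⟩ := hk
    exact Finset.mem_image_of_mem _
      (Finset.mem_range.2 ((strictMono_partialSum f).lt_iff_lt.1 (hkN.trans_le hN)))
  have := (Finset.card_le_card hsub).trans Finset.card_image_le
  rw [Finset.card_range] at this
  omega

theorem continuous_count_bool (N : ℕ) :
    Continuous fun x : ℕ → Bool => Nat.count (fun k => x k = true) N := by
  induction N with
  | zero => simpa using continuous_const
  | succ N ih =>
    simp only [Nat.count_succ]
    exact ih.add ((continuous_of_discreteTopology
      (f := fun b : Bool => if b = true then 1 else 0)).comp (continuous_apply N))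

/-- A compact set of sequences with infinitely many ones admits a uniform bound on the position
of the `n`-th one. -/
theorem IsCompact.exists_forall_lt_count {K : Set (ℕ → Bool)} (hK : IsCompact K)
    (hinf : ∀ x ∈ K, {k | x k = true}.Infinite) (n : ℕ) :
    ∃ N, ∀ x ∈ K, n < Nat.count (fun k => x k = true) N := by
  obtain ⟨N, hN⟩ := hK.elim_directed_cover
    (fun N => {x : ℕ → Bool | n < Nat.count (fun k => x k = true) N})
    (fun N => isOpen_lt continuous_const (continuous_count_bool N))
    (fun x hx => mem_iUnion.2 ⟨Nat.nth (fun k => x k = true) (n + 1), by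
      simp only [mem_ofPred_eq, Nat.count_nth_of_infinite (hinf x hx), Nat.lt_succ_self]⟩)
    (directed_of_isDirected_le fun a b hab x hx => lt_of_lt_of_le hx (Nat.count_monotone _ hab))
  exact ⟨N, hN⟩

/-- If countable subsets are relative `Gδ` sets in every set of size at most `κ`, then every family
of at most `κ` functions is `≤*`-bounded. -/
theorem exists_eventually_le_of_countable_relative_gdelta {κ : Cardinal}
    (hκ : Cardinal.aleph0 ≤ κ)
    (h : ∀ X : Set (ℕ → Bool), Cardinal.mk X ≤ κ →
      ∀ A : Set (ℕ → Bool), A ⊆ X → A.Countable →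
        ∃ U : ℕ → Set (ℕ → Bool), (∀ n, IsOpen (U n)) ∧ A = X ∩ ⋂ n, U n)
    (F : Set (ℕ → ℕ)) (hF : Cardinal.mk F ≤ κ) :
    ∃ g : ℕ → ℕ, ∀ f ∈ F, ∀ᶠ n in Filter.atTop, f n ≤ g n := by
  obtain ⟨U, hU, hQ⟩ := h (partialSumCode '' F ∪ {x | {k | x k = true}.Finite})
    ((Cardinal.mk_union_le _ _).trans (Cardinal.add_le_of_le hκ (Cardinal.mk_image_le.trans hF)
      (countable_setOf_finite_support.le_aleph0.trans hκ)))
    _ subset_union_right countable_setOf_finite_support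
  have hinf : ∀ m, ∀ x ∈ (U m)ᶜ, {k | x k = true}.Infinite := fun m x hx hfin =>
    hx (mem_iInter.1 (hQ.subset hfin).2 m)
  choose G hG using fun m n =>
    (hU m).isClosed_compl.isCompact.exists_forall_lt_count (hinf m) n
  refine ⟨fun k => (Finset.range (k + 1)).sup fun m => G m k, fun f hf => ?_⟩
  have hcode : ¬ {k | partialSumCode f k = true}.Finite := by
    simp only [partialSumCode_eq_true, ofPred_mem_eq]
    exact infinite_range_of_injective (strictMono_partialSum f).injective
  obtain ⟨m, hm⟩ : ∃ m, partialSumCode f ∉ U m := by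
    by_contra! hall
    exact hcode (hQ.superset ⟨Or.inl (mem_image_of_mem _ hf), mem_iInter.2 hall⟩)
  filter_upwards [Filter.eventually_ge_atTop m] with k hk
  calc f k ≤ partialSum f k := le_partialSum f k
    _ ≤ G m k := (lt_of_lt_count_partialSumCode (hG m k _ hm)).le
    _ ≤ _ := Finset.le_sup (f := fun m => G m k) (Finset.mem_range.2 (Nat.lt_succ_of_le hk))

/-- Rothberger: for an infinite cardinal κ, TFAE:
(1) 𝔟 > κ: every family of at most κ functions in ω^ω has a ≤*-upper bound;
(2) every analytic A ⊆ 2^ω agrees on any X of size ≤ κ with a Σ⁰₂ set;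
(3) every Σ⁰₂ set A ⊆ 2^ω agrees on any X of size ≤ κ with a Π⁰₂ set;
(4) every countable A ⊆ X, |X| ≤ κ, is X ∩ B for some Π⁰₂ set B. -/
theorem rothberger_tfae (κ : Cardinal) (hκ : Cardinal.aleph0 ≤ κ) :
    List.TFAE [
      (∀ F : Set (ℕ → ℕ), Cardinal.mk F ≤ κ →
        ∃ g : ℕ → ℕ, ∀ f ∈ F, ∀ᶠ n in Filter.atTop, f n ≤ g n),
      (∀ X : Set (ℕ → Bool), Cardinal.mk X ≤ κ →
        ∀ A : Set (ℕ → Bool), MeasureTheory.AnalyticSet A →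
          ∃ C : ℕ → Set (ℕ → Bool), (∀ n, IsClosed (C n)) ∧ X ∩ A = X ∩ ⋃ n, C n),
      (∀ X : Set (ℕ → Bool), Cardinal.mk X ≤ κ →
        ∀ A : Set (ℕ → Bool),
          (∃ C : ℕ → Set (ℕ → Bool), (∀ n, IsClosed (C n)) ∧ A = ⋃ n, C n) →
          ∃ U : ℕ → Set (ℕ → Bool), (∀ n, IsOpen (U n)) ∧ X ∩ A = X ∩ ⋂ n, U n),
      (∀ X : Set (ℕ → Bool), Cardinal.mk X ≤ κ →
        ∀ A : Set (ℕ → Bool), A ⊆ X → A.Countable →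
          ∃ U : ℕ → Set (ℕ → Bool), (∀ n, IsOpen (U n)) ∧ A = X ∩ ⋂ n, U n)
    ] := by
  tfae_have 1 → 2 := fun h X hX A hA => exists_fsigma_inter_eq_of_analyticSet h hX hA
  tfae_have 2 → 3 := by
    rintro h X hX A ⟨C, hC, rfl⟩
    obtain ⟨D, hD, hXD⟩ := h X hX (⋃ n, C n)ᶜ (by
      borelize (ℕ → Bool)
      have : PolishSpace (ℕ → Bool) := { }
      exact (MeasurableSet.iUnion fun n => (hC n).measurableSet).compl.analyticSet)
    refine ⟨fun n => (D n)ᶜ, fun n => (hD n).isOpen_compl, ?_⟩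
    rw [← compl_iUnion]
    ext x
    have hx := Set.ext_iff.1 hXD x
    simp only [mem_inter_iff, mem_compl_iff] at hx ⊢
    tauto
  tfae_have 3 → 4 := by
    intro h X hX A hAX hA
    obtain ⟨U, hU, hXU⟩ := h X hX A (by
      rcases A.eq_empty_or_nonempty with rfl | hne
      · exact ⟨fun _ => ∅, fun _ => isClosed_empty, by simp⟩
      · obtain ⟨a, rfl⟩ := hA.exists_eq_range hne
        exact ⟨fun n => {a n}, fun n => isClosed_singleton, by simp⟩)
    exact ⟨U, hU, by rw [← hXU, inter_eq_right.2 hAX]⟩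
  tfae_have 4 → 1 := fun h F hF => exists_eventually_le_of_countable_relative_gdelta hκ h F hF
  tfae_finish
end

section
/- For every X ⊆ 2^ω the following are equivalent: (i) there exists Y ⊆ X which is not Borel in X, i.e., Y ≠ X ∩ B for every Borel set B ⊆ 2^ω; (ii) there exists a function f : X → 2^ω such that no Borel function g : 2^ω → 2^ω satisfies g(x) = f(x) for all x ∈ X. (This shows that the two definitions of the cardinal 𝔷 — the least cardinality of a partial function between subsets of 2^ω with no Borel extension, and the least |X| such that some subset of X is not Borel in X — agree.) -/
open Set

/-- X has a subset which is not relatively Borel iff there is a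
function f : X → 2^ω with no Borel extension g : 2^ω → 2^ω. -/
theorem non_rel_borel_iff_no_borel_extension (X : Set (ℕ → Bool)) :
    (∃ Y ⊆ X, ∀ B : Set (ℕ → Bool), MeasurableSet B → Y ≠ X ∩ B) ↔
    (∃ f : X → (ℕ → Bool),
      ¬ ∃ g : (ℕ → Bool) → (ℕ → Bool), Measurable g ∧ ∀ x : X, g ↑x = f x) := by
  classical
  constructor
  · rintro ⟨Y, hYX, hY⟩
    refine ⟨fun x _ => decide (x.1 ∈ Y), ?_⟩
    rintro ⟨g, hg, hgf⟩
    refine hY {x | g x 0 = true}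
      (((measurable_pi_apply 0).comp hg) (measurableSet_singleton true)) ?_
    ext x
    constructor
    · intro hx
      exact ⟨hYX hx, by simp [hgf ⟨x, hYX hx⟩, hx]⟩
    · rintro ⟨hxX, hx⟩
      simpa [hgf ⟨x, hxX⟩] using hx
  · rintro ⟨f, hf⟩
    by_contra! h
    have hB : ∀ n, ∃ B : Set (ℕ → Bool), MeasurableSet B ∧
        {x | ∃ hx : x ∈ X, f ⟨x, hx⟩ n = true} = X ∩ B :=
      fun n => h _ fun _ hx => hx.1
    choose B hBm hB using hB
    refine hf ⟨fun x n => decide (x ∈ B n), ?_, ?_⟩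
    · refine measurable_pi_iff.2 fun n => measurable_to_bool ?_
      simpa [preimage] using hBm n
    · rintro ⟨x, hx⟩
      funext n
      have := Set.ext_iff.1 (hB n) x
      simp only [mem_ofPred_eq, mem_inter_iff, hx, exists_true_left, true_and] at this
      simp [← this]
end
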